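/- arXiv:2006.15670 — 2 statements merged into one kernel-verified Lean document; each statement's English description precedes it below -/
import Mathlib

section
/- Let d ≥ 1 be an integer, b ∈ ℝ^d, σ a d×d real matrix, a = σσᵀ, and c, g ∈ ℝ. For every K > 0 there exists a constant C > 0, depending only on d, K, |b|, |σ|, |c| and |g|, such that the following holds (one-step error of the weak Euler scheme for the parabolic Robin problem, interior step). Let u : ℝ × ℝ^d → ℝ be four times continuously differentiable with all partial derivatives up to order 4 bounded in absolute value by K, let (t,x) ∈ ℝ × ℝ^d satisfy the parabolic equation ∂_t u(t,x) + ∑_{i=1}^d b^i ∂_{x_i} u(t,x) + (1/2) ∑_{i,j=1}^d a^{ij} ∂_{x_i}∂_{x_j} u(t,x) + c·u(t,x) + g = 0, let h ∈ (0,1], y > 0 and z ∈ ℝ, and set Y' = y + h c y and Z' = z + h g y. Then |(2^{-d} ∑_{ξ ∈ {-1,1}^d} u(t+h, x + h b + √h σξ))·Y' + Z' − (u(t,x)·y + z)| ≤ C y h². -/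
open scoped Nat

section Taylor

variable {E : Type*} [NormedAddCommGroup E] [NormedSpace ℝ E]

/-- Taylor's theorem in a normed space, with a polynomial bound on the remainder. -/
lemma abs_sub_taylor_le {u : E → ℝ} {n : ℕ} {K : ℝ} (hu : ContDiff ℝ (n + 1) u)
    (hK : ∀ p, ‖iteratedFDeriv ℝ (n + 1) u p‖ ≤ K) (x v : E) :
    |u (x + v) - ∑ k ∈ Finset.range (n + 1),
        (k ! : ℝ)⁻¹ * iteratedFDeriv ℝ k u x (fun _ ↦ v)| ≤ (n ! : ℝ)⁻¹ * (K * ‖v‖ ^ (n + 1)) := by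
  have h := map_add_eq_sum_add_integral_iteratedFDeriv (f := u) (x := x) (y := v) (n := n)
    fun t _ ↦ hu.contDiffAt
  simp only [smul_eq_mul] at h
  rw [h, add_sub_cancel_left, abs_mul, abs_of_nonneg (by positivity : (0 : ℝ) ≤ (n ! : ℝ)⁻¹)]
  gcongr
  have hb := intervalIntegral.norm_integral_le_of_norm_le_const (a := (0 : ℝ)) (b := 1)
    (C := K * ‖v‖ ^ (n + 1))
    (f := fun t ↦ (1 - t) ^ n * iteratedFDeriv ℝ (n + 1) u (x + t • v) (fun _ ↦ v)) ?_
  · simpa using hb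
  · intro t ht
    rw [Set.uIoc_of_le zero_le_one] at ht
    rw [norm_mul]
    have h1 : ‖(1 - t) ^ n‖ ≤ 1 := by
      rw [norm_pow]
      apply pow_le_one₀ (norm_nonneg _)
      rw [Real.norm_eq_abs, abs_le]
      constructor <;> linarith [ht.1, ht.2]
    have h2 : ‖iteratedFDeriv ℝ (n + 1) u (x + t • v) (fun _ ↦ v)‖ ≤ K * ‖v‖ ^ (n + 1) := by
      refine (ContinuousMultilinearMap.le_opNorm _ _).trans ?_
      rw [Finset.prod_const, Finset.card_univ, Fintype.card_fin]
      gcongr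
      exact hK _
    calc _ ≤ 1 * (K * ‖v‖ ^ (n + 1)) := by gcongr
      _ = _ := one_mul _

/-- First order Taylor bound. -/
lemma abs_sub_sub_fderiv_le {u : E → ℝ} {K : ℝ} (hu : ContDiff ℝ 2 u)
    (hK : ∀ p, ‖iteratedFDeriv ℝ 2 u p‖ ≤ K) (x v : E) :
    |u (x + v) - u x - fderiv ℝ u x v| ≤ K * ‖v‖ ^ 2 := by
  have h := abs_sub_taylor_le (n := 1) (by norm_num; exact hu) hK x v
  simpa [Finset.sum_range_succ, sub_sub] using h

/-- Fourth order error bound for the symmetric second difference. -/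
lemma abs_second_difference_sub_le {u : E → ℝ} {K : ℝ} (hu : ContDiff ℝ 4 u)
    (hK : ∀ p, ‖iteratedFDeriv ℝ 4 u p‖ ≤ K) (x v : E) :
    |u (x + v) + u (x - v) - 2 * u x - fderiv ℝ (fderiv ℝ u) x v v| ≤ K * ‖v‖ ^ 4 / 3 := by
  have hu' : ContDiff ℝ ((3 : ℕ) + 1) u := by norm_num; exact hu
  have h₁ := abs_sub_taylor_le hu' hK x v
  have h₂ := abs_sub_taylor_le hu' hK x (-v)
  have h₃ : iteratedFDeriv ℝ 3 u x (fun _ ↦ -v) = -iteratedFDeriv ℝ 3 u x (fun _ ↦ v) := by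
    have := (iteratedFDeriv ℝ 3 u x).map_smul_univ (fun _ ↦ (-1 : ℝ)) (fun _ ↦ v)
    norm_num at this
    exact this
  simp only [Finset.sum_range_succ, Finset.range_zero, Finset.sum_empty, h₃,
    iteratedFDeriv_two_apply, iteratedFDeriv_one_apply, iteratedFDeriv_zero_apply, norm_neg,
    map_neg, neg_neg, _root_.neg_apply, ← sub_eq_add_neg,
    Nat.factorial] at h₁ h₂
  norm_num at h₁ h₂
  rw [abs_le] at h₁ h₂ ⊢
  constructor <;> linarith [h₁.1, h₁.2, h₂.1, h₂.2]

/-- The second derivative is Lipschitz when the third one is bounded. -/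
lemma norm_fderiv_fderiv_add_sub_le {u : E → ℝ} {K : ℝ} (hu : ContDiff ℝ 3 u)
    (hK : ∀ p, ‖iteratedFDeriv ℝ 3 u p‖ ≤ K) (x v : E) :
    ‖fderiv ℝ (fderiv ℝ u) (x + v) - fderiv ℝ (fderiv ℝ u) x‖ ≤ K * ‖v‖ := by
  have h₁ : ContDiff ℝ 2 (fderiv ℝ u) := hu.fderiv_right (by norm_num)
  have h₂ : ContDiff ℝ 1 (fderiv ℝ (fderiv ℝ u)) := h₁.fderiv_right (by norm_num)
  have h := convex_univ.norm_image_sub_le_of_norm_fderiv_le (𝕜 := ℝ)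
    (fun p _ ↦ (h₂.differentiable (by norm_num)).differentiableAt (x := p)) (C := K)
    (fun p _ ↦ ?_) (Set.mem_univ x) (Set.mem_univ (x + v))
  · simpa using h
  · rw [← norm_iteratedFDeriv_one, norm_iteratedFDeriv_fderiv, norm_iteratedFDeriv_fderiv]
    exact hK p

end Taylor

section Rademacher

/-- The sign attached to a Boolean. -/
def rademacherSign (β : Bool) : ℝ := if β then 1 else -1

@[simp] lemma rademacherSign_not (β : Bool) : rademacherSign (!β) = -rademacherSign β := by
  cases β <;> simp [rademacherSign]

@[simp] lemma abs_rademacherSign (β : Bool) : |rademacherSign β| = 1 := by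
  cases β <;> simp [rademacherSign]

@[simp] lemma rademacherSign_mul_self (β : Bool) : rademacherSign β * rademacherSign β = 1 := by
  cases β <;> simp [rademacherSign]

variable {ι : Type*} [Fintype ι]

lemma sum_rademacherSign_mul [DecidableEq ι] (i j : ι) :
    ∑ ξ : ι → Bool, rademacherSign (ξ i) * rademacherSign (ξ j)
      = if i = j then (2 : ℝ) ^ Fintype.card ι else 0 := by
  split_ifs with hij
  · subst hij
    simp
  · have hinv : Function.Involutive fun ξ : ι → Bool ↦ Function.update ξ i (!ξ i) := by
      intro ξ
      simp
    have h := Equiv.sum_comp (hinv.toPerm _)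
      fun ξ : ι → Bool ↦ rademacherSign (ξ i) * rademacherSign (ξ j)
    simp only [Function.Involutive.coe_toPerm, Function.update_self, rademacherSign_not,
      Function.update_of_ne (Ne.symm hij), neg_mul, Finset.sum_neg_distrib] at h
    linarith

variable {E : Type*} [NormedAddCommGroup E] [NormedSpace ℝ E]

lemma sum_bilin_rademacher [DecidableEq ι] (B : E →L[ℝ] E →L[ℝ] ℝ) (s : ι → E) :
    ∑ ξ : ι → Bool, B (∑ k, rademacherSign (ξ k) • s k) (∑ k, rademacherSign (ξ k) • s k)
      = 2 ^ Fintype.card ι * ∑ k, B (s k) (s k) := by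
  simp only [map_sum, map_smul, _root_.sum_apply, _root_.smul_apply,
    smul_eq_mul, Finset.mul_sum, ← mul_assoc]
  rw [Finset.sum_comm]
  refine Finset.sum_congr rfl fun k _ ↦ ?_
  rw [Finset.sum_comm]
  simp_rw [← Finset.sum_mul, sum_rademacherSign_mul]
  simp

lemma norm_sum_rademacherSign_smul_le (ξ : ι → Bool) (s : ι → E) :
    ‖∑ k, rademacherSign (ξ k) • s k‖ ≤ ∑ k, ‖s k‖ :=
  (norm_sum_le _ _).trans_eq <| by simp [norm_smul]

/-- Weak Taylor expansion of the Rademacher average of `u` around `q`. -/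
lemma abs_rademacher_average_sub_le [DecidableEq ι] {u : E → ℝ} {K : ℝ} (hu : ContDiff ℝ 4 u)
    (hK : ∀ p, ‖iteratedFDeriv ℝ 4 u p‖ ≤ K) (q : E) (s : ι → E) (r : ℝ) :
    |((2 : ℝ) ^ Fintype.card ι)⁻¹ * ∑ ξ : ι → Bool, u (q + r • ∑ k, rademacherSign (ξ k) • s k)
        - u q - r ^ 2 / 2 * ∑ k, fderiv ℝ (fderiv ℝ u) q (s k) (s k)|
      ≤ K * (∑ k, ‖s k‖) ^ 4 / 6 * r ^ 4 := by
  have hK₀ : 0 ≤ K := (norm_nonneg _).trans (hK q)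
  set N : ℝ := 2 ^ Fintype.card ι with hN
  have hN₀ : 0 < N := by positivity
  set w : (ι → Bool) → E := fun ξ ↦ ∑ k, rademacherSign (ξ k) • s k with hw
  have hinv : Function.Involutive fun (ξ : ι → Bool) k ↦ !ξ k := fun ξ ↦ by simp
  have hsymm : ∑ ξ, u (q - r • w ξ) = ∑ ξ, u (q + r • w ξ) := by
    rw [← Equiv.sum_comp (hinv.toPerm _) fun ξ ↦ u (q + r • w ξ)]
    simp [hw, sub_eq_add_neg]
  have hbil : ∑ ξ, fderiv ℝ (fderiv ℝ u) q (r • w ξ) (r • w ξ)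
      = r ^ 2 * (N * ∑ k, fderiv ℝ (fderiv ℝ u) q (s k) (s k)) := by
    rw [hN, ← sum_bilin_rademacher, Finset.mul_sum]
    refine Finset.sum_congr rfl fun ξ _ ↦ ?_
    simp only [map_smul, _root_.smul_apply, smul_eq_mul, hw]
    ring
  have hcard : ∑ _ξ : ι → Bool, (1 : ℝ) = N := by simp [hN]
  have hsum : |∑ ξ, (u (q + r • w ξ) + u (q - r • w ξ) - 2 * u q
      - fderiv ℝ (fderiv ℝ u) q (r • w ξ) (r • w ξ))|
      ≤ N * (K * (∑ k, ‖s k‖) ^ 4 / 3 * r ^ 4) := by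
    rw [← hcard, Finset.sum_mul]
    refine (Finset.abs_sum_le_sum_abs _ _).trans (Finset.sum_le_sum fun ξ _ ↦ ?_)
    refine (abs_second_difference_sub_le hu hK q (r • w ξ)).trans ?_
    rw [norm_smul, mul_pow, Real.norm_eq_abs, (by decide : Even 4).pow_abs]
    have : ‖w ξ‖ ^ 4 ≤ (∑ k, ‖s k‖) ^ 4 := by
      gcongr
      exact norm_sum_rademacherSign_smul_le ξ s
    have : K * r ^ 4 * ‖w ξ‖ ^ 4 ≤ K * r ^ 4 * (∑ k, ‖s k‖) ^ 4 := by gcongr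
    linarith
  rw [Finset.sum_sub_distrib, Finset.sum_sub_distrib, Finset.sum_add_distrib, hsymm, hbil,
    ← mul_one (2 * u q), ← Finset.mul_sum, hcard] at hsum
  set S := ∑ ξ, u (q + r • w ξ)
  have hfac : N⁻¹ * S - u q - r ^ 2 / 2 * ∑ k, fderiv ℝ (fderiv ℝ u) q (s k) (s k)
      = (2 * N)⁻¹ * (S + S - 2 * u q * N
        - r ^ 2 * (N * ∑ k, fderiv ℝ (fderiv ℝ u) q (s k) (s k))) := by
    field_simp
    ring
  rw [hfac, abs_mul, abs_of_pos (by positivity : 0 < (2 * N)⁻¹)]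
  calc _ ≤ (2 * N)⁻¹ * (N * (K * (∑ k, ‖s k‖) ^ 4 / 3 * r ^ 4)) := by gcongr
    _ = _ := by field_simp; ring

/-- One-step weak expansion of a Rademacher walk with drift `e` and noise directions `s k`. -/
lemma abs_rademacher_step_sub_le [DecidableEq ι] {u : E → ℝ} {K : ℝ} (hu : ContDiff ℝ 4 u)
    (hK : ∀ n ≤ 4, ∀ p, ‖iteratedFDeriv ℝ n u p‖ ≤ K) (p e : E) (s : ι → E) {h : ℝ}
    (hh : 0 ≤ h) :
    |((2 : ℝ) ^ Fintype.card ι)⁻¹ *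
          ∑ ξ : ι → Bool, u (p + h • e + Real.sqrt h • ∑ k, rademacherSign (ξ k) • s k)
        - u p - h * (fderiv ℝ u p e + 1 / 2 * ∑ k, fderiv ℝ (fderiv ℝ u) p (s k) (s k))|
      ≤ K * ((∑ k, ‖s k‖) ^ 4 / 6 + ‖e‖ ^ 2 + ‖e‖ * (∑ k, ‖s k‖ ^ 2) / 2) * h ^ 2 := by
  have h₁ := abs_rademacher_average_sub_le hu (hK 4 le_rfl) (p + h • e) s (Real.sqrt h)
  have h₂ := abs_sub_sub_fderiv_le (hu.of_le (by norm_num)) (hK 2 (by norm_num)) p (h • e)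
  have h₃ : |∑ k, fderiv ℝ (fderiv ℝ u) (p + h • e) (s k) (s k)
      - ∑ k, fderiv ℝ (fderiv ℝ u) p (s k) (s k)| ≤ K * (h * ‖e‖) * ∑ k, ‖s k‖ ^ 2 := by
    rw [← Finset.sum_sub_distrib, Finset.mul_sum]
    refine (Finset.abs_sum_le_sum_abs _ _).trans (Finset.sum_le_sum fun k _ ↦ ?_)
    have hlip := norm_fderiv_fderiv_add_sub_le (hu.of_le (by norm_num)) (hK 3 (by norm_num))
      p (h • e)
    rw [norm_smul, Real.norm_of_nonneg hh] at hlip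
    have hop := ContinuousLinearMap.le_opNorm₂
      (fderiv ℝ (fderiv ℝ u) (p + h • e) - fderiv ℝ (fderiv ℝ u) p) (s k) (s k)
    rw [mul_assoc, ← sq] at hop
    exact hop.trans (by gcongr)
  have h₄ := mul_le_mul_of_nonneg_left h₃ (by positivity : 0 ≤ h / 2)
  rw [← abs_of_nonneg (by positivity : 0 ≤ h / 2), ← abs_mul, abs_of_nonneg
    (by positivity : 0 ≤ h / 2)] at h₄
  rw [Real.sq_sqrt hh, (by rw [← Real.sq_sqrt hh]; ring_nf; simp [Real.sqrt_sq] :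
    Real.sqrt h ^ 4 = h ^ 2)] at h₁
  rw [norm_smul, Real.norm_of_nonneg hh, map_smul, smul_eq_mul] at h₂
  rw [abs_le] at h₁ h₂ h₄ ⊢
  constructor <;> nlinarith [h₁.1, h₁.2, h₂.1, h₂.2, h₄.1, h₄.2]

end Rademacher

/-- Contraction of a bilinear map with `σ σᵀ` as a sum over the columns of `σ`. -/
lemma sum_bilin_columns {ι κ E : Type*} [Fintype ι] [Fintype κ] [NormedAddCommGroup E]
    [NormedSpace ℝ E] (B : E →L[ℝ] E →L[ℝ] ℝ) (σ : Matrix ι κ ℝ) (e : ι → E) :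
    ∑ k, B (∑ i, σ i k • e i) (∑ i, σ i k • e i)
      = ∑ i, ∑ j, (σ * σ.transpose) i j * B (e i) (e j) := by
  simp only [map_sum, map_smul, _root_.sum_apply, _root_.smul_apply,
    smul_eq_mul, Finset.mul_sum, Matrix.mul_apply, Matrix.transpose_apply, Finset.sum_mul]
  rw [Finset.sum_comm]
  conv_rhs => rw [Finset.sum_comm]
  refine Finset.sum_congr rfl fun j _ ↦ ?_
  rw [Finset.sum_comm]
  refine Finset.sum_congr rfl fun i _ ↦ Finset.sum_congr rfl fun k _ ↦ ?_
  ring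


/-- One-step error of the weak Euler scheme for the parabolic Robin problem
(interior step): if `u` solves the parabolic PDE at `(t,x)`, then the one-step
value `E[u(t+h, X')·Y' + Z']` approximates `u(t,x)·y + z` with error `≤ C y h²`. -/
theorem weak_euler_one_step_error_parabolic_robin
    (d : ℕ) (hd : 1 ≤ d) (b : Fin d → ℝ) (σ : Matrix (Fin d) (Fin d) ℝ)
    (c g : ℝ) (K : ℝ) (hK : 0 < K) :
    ∃ C : ℝ, 0 < C ∧
      ∀ (u : ℝ × (Fin d → ℝ) → ℝ),
        ContDiff ℝ 4 u →
        (∀ n : ℕ, n ≤ 4 → ∀ p, ‖iteratedFDeriv ℝ n u p‖ ≤ K) →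
        ∀ (t : ℝ) (x : Fin d → ℝ),
          (fderiv ℝ u (t, x) (1, 0)
              + ∑ i, b i * fderiv ℝ u (t, x) (0, Pi.single i 1)
              + (1 / 2) * ∑ i, ∑ j, (σ * σ.transpose) i j *
                  fderiv ℝ (fun p => fderiv ℝ u p (0, Pi.single j 1)) (t, x)
                    (0, Pi.single i 1)
              + c * u (t, x) + g = 0) →
        ∀ (h : ℝ), 0 < h → h ≤ 1 →
        ∀ (y z : ℝ), 0 < y →
          |((2 : ℝ) ^ d)⁻¹ *
              (∑ ξ : Fin d → Bool,
                u (t + h, fun i => x i + h * b i +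
                  Real.sqrt h * ∑ j, σ i j * (if ξ j then (1 : ℝ) else -1)))
              * (y + h * c * y)
            + (z + h * g * y)
            - (u (t, x) * y + z)|
          ≤ C * y * h ^ 2 := by
  classical
  set e : ℝ × (Fin d → ℝ) := (1, b) with he
  set s : Fin d → ℝ × (Fin d → ℝ) := fun k ↦ ∑ i, σ i k • ((0 : ℝ), Pi.single i (1 : ℝ)) with hs
  set A : ℝ := (∑ k, ‖s k‖) ^ 4 / 6 + ‖e‖ ^ 2 + ‖e‖ * (∑ k, ‖s k‖ ^ 2) / 2 with hA
  have hA₀ : 0 ≤ A := by positivity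
  refine ⟨K * A * (1 + |c|) + |c| * (|c| * K + |g|) + 1, by positivity, ?_⟩
  intro u hu hbd t x hpde h hh₀ hh₁ y z hy
  have hs' : ∀ k, s k = (0, fun i ↦ σ i k) := by
    intro k
    ext i
    · simp [hs, Prod.fst_sum]
    · simp [hs, Prod.snd_sum, Pi.single_apply]
  have hpt : ∀ ξ : Fin d → Bool,
      (t + h, fun i => x i + h * b i +
          Real.sqrt h * ∑ j, σ i j * (if ξ j then (1 : ℝ) else -1))
        = (t, x) + h • e + Real.sqrt h • ∑ k, rademacherSign (ξ k) • s k := by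
    intro ξ
    have hnoise : ∑ k, rademacherSign (ξ k) • s k
        = (0, fun i ↦ ∑ j, σ i j * rademacherSign (ξ j)) := by
      ext i
      · simp [hs', Prod.fst_sum]
      · simp [hs', Prod.snd_sum, mul_comm]
    rw [hnoise]
    ext i
    · simp [he]
    · simp [he, rademacherSign]
  have hdrift : fderiv ℝ u (t, x) e = fderiv ℝ u (t, x) (1, 0)
      + ∑ i, b i * fderiv ℝ u (t, x) (0, Pi.single i 1) := by
    have : e = (1, 0) + ∑ i, b i • ((0 : ℝ), Pi.single i (1 : ℝ)) := by
      ext i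
      · simp [he, Prod.fst_sum]
      · simp [he, Prod.snd_sum, Pi.single_apply]
    rw [this, map_add, map_sum]
    simp only [map_smul, smul_eq_mul]
  have hdiff : DifferentiableAt ℝ (fderiv ℝ u) (t, x) :=
    ((hu.fderiv_right (m := 3) (by norm_num)).differentiable (by norm_num)).differentiableAt
  have hsecond : ∀ v w : ℝ × (Fin d → ℝ), fderiv ℝ (fun p => fderiv ℝ u p v) (t, x) w
      = fderiv ℝ (fderiv ℝ u) (t, x) w v := by
    intro v w
    rw [fderiv_clm_apply hdiff (differentiableAt_const v)]
    simp
  simp only [hsecond, ← hdrift] at hpde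
  rw [← sum_bilin_columns (fderiv ℝ (fderiv ℝ u) (t, x)) σ
    fun i ↦ ((0 : ℝ), Pi.single i (1 : ℝ))] at hpde
  have hstep := abs_rademacher_step_sub_le hu hbd (t, x) e s hh₀.le
  rw [Fintype.card_fin] at hstep
  simp only [hpt]
  set M := ((2 : ℝ) ^ d)⁻¹ *
    ∑ ξ : Fin d → Bool, u ((t, x) + h • e + Real.sqrt h • ∑ k, rademacherSign (ξ k) • s k)
  have hgen : fderiv ℝ u (t, x) e + 1 / 2 * ∑ k, fderiv ℝ (fderiv ℝ u) (t, x) (s k) (s k)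
      = -(c * u (t, x) + g) := by
    linarith
  rw [hgen] at hstep
  set R := M - u (t, x) - h * -(c * u (t, x) + g) with hR
  have hu₀ : |u (t, x)| ≤ K := by simpa using hbd 0 (by norm_num) (t, x)
  have hid : M * (y + h * c * y) + (z + h * g * y) - (u (t, x) * y + z)
      = y * (R * (1 + h * c) - h ^ 2 * (c * (c * u (t, x) + g))) := by
    rw [hR]
    ring
  rw [hid, abs_mul, abs_of_pos hy]
  have h₁ : |1 + h * c| ≤ 1 + |c| := by
    refine (abs_add_le _ _).trans ?_
    rw [abs_one, abs_mul, abs_of_pos hh₀]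
    gcongr
    exact mul_le_of_le_one_left (abs_nonneg c) hh₁
  have h₂ : |c * (c * u (t, x) + g)| ≤ |c| * (|c| * K + |g|) := by
    rw [abs_mul]
    gcongr
    refine (abs_add_le _ _).trans ?_
    rw [abs_mul]
    gcongr
  calc y * |R * (1 + h * c) - h ^ 2 * (c * (c * u (t, x) + g))|
      ≤ y * (|R| * |1 + h * c| + h ^ 2 * |c * (c * u (t, x) + g)|) := by
        gcongr
        refine (abs_sub _ _).trans_eq ?_
        rw [abs_mul, abs_mul (h ^ 2), abs_of_nonneg (sq_nonneg h)]
    _ ≤ y * (K * A * h ^ 2 * (1 + |c|) + h ^ 2 * (|c| * (|c| * K + |g|))) := by gcongr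
    _ ≤ (K * A * (1 + |c|) + |c| * (|c| * K + |g|) + 1) * y * h ^ 2 := by
        have : 0 ≤ y * h ^ 2 := by positivity
        linarith
end

section
/- Let d ≥ 1 be an integer and K > 0, c, γ, ψ ∈ ℝ. There exists a constant C > 0, depending only on K, |c|, |γ| and |ψ|, such that the following holds (one-step error of the reflection step under a Robin boundary condition). Let u : ℝ^d → ℝ be three times continuously differentiable with all partial derivatives up to order 3 bounded in absolute value by K, let z ∈ ℝ^d, let ν ∈ ℝ^d be a unit vector, and suppose the Robin relation ⟨∇u(z), ν⟩ + γ·u(z) = ψ holds at z. Let h ∈ (0,1] and r ≥ 0 with r² ≤ h, let y > 0, z₀ ∈ ℝ and g ∈ ℝ, and define Y₊ = y + h c y + 2 r γ y + 2 r² γ² y, Y₋ = y + h c y, Z₊ = z₀ + h g y − 2 r ψ y − 2 r² ψ γ y, Z₋ = z₀ + h g y. Then |u(z + rν)·Y₊ + Z₊ − (u(z − rν)·Y₋ + Z₋)| ≤ C y h r. -/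
open Set Finset in
/-- Taylor's theorem along a segment, with a uniform bound on the next derivative. -/
theorem abs_sub_taylor_sum_le {E : Type*} [NormedAddCommGroup E] [NormedSpace ℝ E]
    {f : E → ℝ} {n : ℕ} {K : ℝ} (hf : ContDiff ℝ (n + 1) f)
    (hK : ∀ p, ‖iteratedFDeriv ℝ (n + 1) f p‖ ≤ K) (z w : E) :
    |f (z + w) - ∑ k ∈ range (n + 1),
        (k.factorial : ℝ)⁻¹ * iteratedFDeriv ℝ k f z (fun _ => w)|
      ≤ K * ‖w‖ ^ (n + 1) / (n + 1).factorial := by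
  set L : ℝ →L[ℝ] E := ContinuousLinearMap.toSpanSingleton ℝ w with hL
  set φ : ℝ → ℝ := (fun x => f (z + x)) ∘ L with hφ
  have hg : ContDiff ℝ (n + 1) (fun x => f (z + x)) := hf.comp (contDiff_const.add contDiff_id)
  have hφc : ContDiff ℝ (n + 1) φ := hg.comp L.contDiff
  have hder : ∀ k ≤ n + 1, ∀ t,
      iteratedDeriv k φ t = iteratedFDeriv ℝ k f (z + t • w) (fun _ => w) := by
    intro k hk t
    rw [iteratedDeriv_eq_iteratedFDeriv, hφ,
      L.iteratedFDeriv_comp_right hg t (by exact_mod_cast hk), iteratedFDeriv_comp_add_left]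
    simp [hL, ContinuousMultilinearMap.compContinuousLinearMap_apply]
  obtain ⟨t, -, ht⟩ := taylor_mean_remainder_lagrange_iteratedDeriv (f := φ) (n := n)
    (zero_ne_one (α := ℝ)) hφc.contDiffOn
  have hsum : taylorWithinEval φ n (uIcc 0 1) 0 1 = ∑ k ∈ range (n + 1),
      (k.factorial : ℝ)⁻¹ * iteratedFDeriv ℝ k f z (fun _ => w) := by
    rw [taylor_within_apply]
    refine sum_congr rfl fun k hk => ?_
    have hk' : k ≤ n + 1 := (mem_range.1 hk).le
    rw [iteratedDerivWithin_eq_iteratedDeriv (uniqueDiffOn_uIcc zero_ne_one)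
      (hφc.contDiffAt.of_le (by exact_mod_cast hk')) left_mem_uIcc, hder k hk']
    simp
  have h1 : φ 1 = f (z + w) := by simp [hφ, hL]
  rw [← h1, ← hsum, ht, hder _ le_rfl, sub_zero, one_pow, mul_one, abs_div, Nat.abs_cast]
  gcongr
  calc |iteratedFDeriv ℝ (n + 1) f (z + t • w) (fun _ => w)|
      ≤ ‖iteratedFDeriv ℝ (n + 1) f (z + t • w)‖ * ∏ _i : Fin (n + 1), ‖w‖ :=
        (iteratedFDeriv ℝ (n + 1) f (z + t • w)).le_opNorm fun _ => w
    _ ≤ K * ‖w‖ ^ (n + 1) := by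
        rw [prod_const, card_univ, Fintype.card_fin]
        gcongr
        exact hK _

/-- One-step error of the symmetrized reflection step under a Robin boundary
condition: if `⟨∇u(z), ν⟩ + γ·u(z) = ψ` at a boundary point `z` with inward
unit normal `ν`, then the reflected update of `(X, Y, Z)` has one-step error
`≤ C y h r`. -/
theorem reflection_one_step_error_robin
    (d : ℕ) (hd : 1 ≤ d) (K c γ ψ : ℝ) (hK : 0 < K) :
    ∃ C : ℝ, 0 < C ∧
      ∀ (u : EuclideanSpace ℝ (Fin d) → ℝ),
        ContDiff ℝ 3 u →
        (∀ n : ℕ, n ≤ 3 → ∀ p, ‖iteratedFDeriv ℝ n u p‖ ≤ K) →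
        ∀ (z ν : EuclideanSpace ℝ (Fin d)), ‖ν‖ = 1 →
          (fderiv ℝ u z ν + γ * u z = ψ) →
        ∀ (h r : ℝ), 0 < h → h ≤ 1 → 0 ≤ r → r ^ 2 ≤ h →
        ∀ (y z₀ g : ℝ), 0 < y →
          |u (z + r • ν) * (y + h * c * y + 2 * r * γ * y + 2 * r ^ 2 * γ ^ 2 * y)
              + (z₀ + h * g * y - 2 * r * ψ * y - 2 * r ^ 2 * ψ * γ * y)
            - (u (z - r • ν) * (y + h * c * y) + (z₀ + h * g * y))|
          ≤ C * y * h * r := by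
  refine ⟨K * (1 + 2 * |c| + |γ| + 2 * γ ^ 2), by positivity, ?_⟩
  intro u hu hbd z ν hν hrobin h r hh _ hr hrh y z₀ g hy
  have hν' : ‖r • ν‖ = r := by rw [norm_smul, hν, mul_one, Real.norm_of_nonneg hr]
  have hneg : ‖-(r • ν)‖ = r := by rw [norm_neg, hν']
  have hquad : iteratedFDeriv ℝ 2 u z (fun _ => -(r • ν)) =
      iteratedFDeriv ℝ 2 u z (fun _ => r • ν) := by
    simp [iteratedFDeriv_two_apply]
  have p0 := abs_sub_taylor_sum_le (n := 0) (hu.of_le (by norm_num)) (hbd 1 (by norm_num)) z (r • ν)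
  have m0 := abs_sub_taylor_sum_le (n := 0) (hu.of_le (by norm_num)) (hbd 1 (by norm_num)) z
    (-(r • ν))
  have p1 := abs_sub_taylor_sum_le (n := 1) (hu.of_le (by norm_num)) (hbd 2 (by norm_num)) z (r • ν)
  have p2 := abs_sub_taylor_sum_le (n := 2) (hu.of_le (by norm_num)) (hbd 3 (by norm_num)) z (r • ν)
  have m2 := abs_sub_taylor_sum_le (n := 2) (hu.of_le (by norm_num)) (hbd 3 (by norm_num)) z
    (-(r • ν))
  rw [hν'] at p0 p1 p2
  rw [hneg, ← sub_eq_add_neg] at m0 m2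
  simp only [Finset.sum_range_succ, Finset.sum_range_zero, hquad, iteratedFDeriv_zero_apply,
    iteratedFDeriv_one_apply, map_neg, map_smul, smul_eq_mul, Nat.factorial, Nat.cast_one,
    inv_one, one_mul, zero_add, pow_one, div_one, mul_one] at p0 m0 p1 p2 m2
  norm_num at p0 m0 p1 p2 m2
  generalize iteratedFDeriv ℝ 2 u z (fun _ => r • ν) = q at p2 m2
  generalize u (z + r • ν) = a at *
  generalize u (z - r • ν) = b at *
  generalize fderiv ℝ u z ν = D at *
  generalize u z = e at *
  subst hrobin
  have hr3 : r ^ 3 ≤ h * r := by nlinarith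
  have hdiff : |a - b| ≤ 2 * K * r := by
    rw [abs_le] at *; constructor <;> linarith [p0.1, p0.2, m0.1, m0.2]
  have hsymm : |a - b - 2 * r * D| ≤ K * r ^ 3 := by
    have : 0 ≤ K * r ^ 3 := by positivity
    rw [abs_le] at *; constructor <;> linarith [p2.1, p2.2, m2.1, m2.2]
  have key : a * (y + h * c * y + 2 * r * γ * y + 2 * r ^ 2 * γ ^ 2 * y)
      + (z₀ + h * g * y - 2 * r * (D + γ * e) * y - 2 * r ^ 2 * (D + γ * e) * γ * y)
      - (b * (y + h * c * y) + (z₀ + h * g * y)) =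
      y * ((a - b - 2 * r * D) + h * c * (a - b) + 2 * r * γ * (a - (e + r * D))
        + 2 * r ^ 2 * γ ^ 2 * (a - e)) := by ring
  rw [key, abs_mul, abs_of_pos hy]
  calc y * |(a - b - 2 * r * D) + h * c * (a - b) + 2 * r * γ * (a - (e + r * D))
        + 2 * r ^ 2 * γ ^ 2 * (a - e)|
      ≤ y * (|a - b - 2 * r * D| + |h * c * (a - b)| + |2 * r * γ * (a - (e + r * D))|
        + |2 * r ^ 2 * γ ^ 2 * (a - e)|) := by
        gcongr
        exact (abs_add_le _ _).trans (by gcongr; exact abs_add_three _ _ _)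
    _ = y * (|a - b - 2 * r * D| + h * |c| * |a - b| + 2 * r * |γ| * |a - (e + r * D)|
        + 2 * r ^ 2 * γ ^ 2 * |a - e|) := by
        simp only [abs_mul, abs_of_pos hh, abs_of_nonneg hr, abs_pow, sq_abs, abs_two]
    _ ≤ y * (K * r ^ 3 + h * |c| * (2 * K * r) + 2 * r * |γ| * (K * r ^ 2 / 2)
        + 2 * r ^ 2 * γ ^ 2 * (K * r)) := by gcongr
    _ = y * (2 * h * |c| * K * r + K * (1 + |γ| + 2 * γ ^ 2) * r ^ 3) := by ring
    _ ≤ y * (2 * h * |c| * K * r + K * (1 + |γ| + 2 * γ ^ 2) * (h * r)) := by gcongr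
    _ = K * (1 + 2 * |c| + |γ| + 2 * γ ^ 2) * y * h * r := by ring
end
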